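/- Let Φ : M_2(ℂ) → M_2(ℂ) be a positive linear map (i.e. Φ maps positive semidefinite matrices to positive semidefinite matrices). For a unit vector ψ ∈ ℂ², define the transmitted mistake rate e(ψ) = tr[Φ(|ψ⟩⟨ψ|)(I − |ψ⟩⟨ψ|)], which is a nonnegative real number. Let E_max = sup over unit vectors ψ of e(ψ) and E_av = ∫ e(ψ) dμ(ψ), where μ is the uniform (rotation-invariant) probability measure on the unit sphere of ℂ². Then E_av ≤ E_max ≤ 4·E_av. -/

import Mathlib

open scoped Matrix ComplexOrder
open MeasureTheory

noncomputable instance : MeasurableSpace (EuclideanSpace ℂ (Fin 2)) := borel _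
instance : BorelSpace (EuclideanSpace ℂ (Fin 2)) := ⟨rfl⟩

/-- The rank-one projection `|ψ⟩⟨ψ|` associated to a vector `ψ ∈ ℂ²`. -/
noncomputable def projMat (ψ : EuclideanSpace ℂ (Fin 2)) : Matrix (Fin 2) (Fin 2) ℂ :=
  Matrix.of fun i j => ψ i * (starRingEnd ℂ) (ψ j)

/-- The transmitted mistake rate `e(ψ) = tr[Φ(|ψ⟩⟨ψ|)(I - |ψ⟩⟨ψ|)]`. -/
noncomputable def mistakeRate (Φ : Matrix (Fin 2) (Fin 2) ℂ →ₗ[ℂ] Matrix (Fin 2) (Fin 2) ℂ)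
    (ψ : EuclideanSpace ℂ (Fin 2)) : ℝ :=
  ((Φ (projMat ψ) * (1 - projMat ψ)).trace).re

/-- Bloch coordinates. -/
noncomputable def blX (ψ : EuclideanSpace ℂ (Fin 2)) : ℝ :=
  2 * ((ψ 0).re * (ψ 1).re + (ψ 0).im * (ψ 1).im)
/-- Bloch coordinates. -/
noncomputable def blY (ψ : EuclideanSpace ℂ (Fin 2)) : ℝ :=
  2 * ((ψ 0).re * (ψ 1).im - (ψ 0).im * (ψ 1).re)
/-- Bloch coordinates. -/
noncomputable def blZ (ψ : EuclideanSpace ℂ (Fin 2)) : ℝ :=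
  (ψ 0).re ^ 2 + (ψ 0).im ^ 2 - (ψ 1).re ^ 2 - (ψ 1).im ^ 2

/-- A general quadratic polynomial on three-space. -/
def quadPoly (c b1 b2 b3 q11 q22 q33 q12 q13 q23 x y z : ℝ) : ℝ :=
  c + b1 * x + b2 * y + b3 * z + q11 * x ^ 2 + q22 * y ^ 2 + q33 * z ^ 2
    + q12 * (x * y) + q13 * (x * z) + q23 * (y * z)

lemma unit_coords (ψ : EuclideanSpace ℂ (Fin 2)) (h : ‖ψ‖ = 1) :
    (ψ 0).re ^ 2 + (ψ 0).im ^ 2 + (ψ 1).re ^ 2 + (ψ 1).im ^ 2 = 1 := by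
  have h2 := EuclideanSpace.norm_sq_eq ψ
  rw [h] at h2
  simp only [Fin.sum_univ_two, Complex.sq_norm, Complex.normSq_apply] at h2
  nlinarith

lemma norm_of_coords (ψ : EuclideanSpace ℂ (Fin 2))
    (h : (ψ 0).re ^ 2 + (ψ 0).im ^ 2 + (ψ 1).re ^ 2 + (ψ 1).im ^ 2 = 1) : ‖ψ‖ = 1 := by
  have h2 := EuclideanSpace.norm_sq_eq ψ
  simp only [Fin.sum_univ_two, Complex.sq_norm, Complex.normSq_apply] at h2
  have : ‖ψ‖ ^ 2 = 1 := by nlinarith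
  have h0 := norm_nonneg ψ
  nlinarith

/-- Bloch sphere is covered. -/
lemma bloch_surj (x y z : ℝ) (h : x ^ 2 + y ^ 2 + z ^ 2 = 1) :
    ∃ ψ : EuclideanSpace ℂ (Fin 2), ‖ψ‖ = 1 ∧ blX ψ = x ∧ blY ψ = y ∧ blZ ψ = z := by
  by_cases hz : z = -1
  · have hx : x = 0 := by
      have : x ^ 2 + y ^ 2 = 0 := by rw [hz] at h; linarith
      nlinarith [sq_nonneg x, sq_nonneg y]
    have hy : y = 0 := by
      have : x ^ 2 + y ^ 2 = 0 := by rw [hz] at h; linarith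
      nlinarith [sq_nonneg x, sq_nonneg y]
    refine ⟨!₂[(0 : ℂ), 1], norm_of_coords _ ?_, ?_, ?_, ?_⟩ <;>
      simp [blX, blY, blZ, hx, hy, hz]
  · have h1 : 0 < 1 + z := by
      have : -1 ≤ z := by nlinarith [sq_nonneg x, sq_nonneg y]
      rcases this.lt_or_eq with h | h
      · linarith
      · exact absurd h.symm hz
    obtain ⟨a, ha, ha2⟩ : ∃ a : ℝ, 0 < a ∧ a ^ 2 = (1 + z) / 2 :=
      ⟨√((1 + z) / 2), by positivity, Real.sq_sqrt (by positivity)⟩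
    have hzz : z = 2 * a ^ 2 - 1 := by linarith
    have hxy : x ^ 2 + y ^ 2 = 4 * a ^ 2 * (1 - a ^ 2) := by rw [hzz] at h; linarith
    have hs : (x / (2 * a)) ^ 2 + (y / (2 * a)) ^ 2 = 1 - a ^ 2 := by
      rw [div_pow, div_pow, ← add_div, hxy]
      field_simp
      ring
    refine ⟨!₂[(⟨a, 0⟩ : ℂ), ⟨x / (2 * a), y / (2 * a)⟩], norm_of_coords _ ?_, ?_, ?_, ?_⟩
    · simp
      linarith
    · simp [blX]
      field_simp
    · simp [blY]
      field_simp
    · simp [blZ]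
      linarith

lemma bloch_unit (ψ : EuclideanSpace ℂ (Fin 2)) (h : ‖ψ‖ = 1) :
    blX ψ ^ 2 + blY ψ ^ 2 + blZ ψ ^ 2 = 1 := by
  have h1 := unit_coords ψ h
  simp only [blX, blY, blZ]
  linear_combination ((ψ 0).re ^ 2 + (ψ 0).im ^ 2 + (ψ 1).re ^ 2 + (ψ 1).im ^ 2 + 1) * h1

lemma proj_nonneg (A : Matrix (Fin 2) (Fin 2) ℂ) (hA : A.PosSemidef)
    (φ : EuclideanSpace ℂ (Fin 2)) : 0 ≤ ((A * projMat φ).trace).re := by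
  have h := hA.dotProduct_mulVec_nonneg (fun i => φ i)
  have h2 : (A * projMat φ).trace = star (fun i => φ i) ⬝ᵥ (A *ᵥ (fun i => φ i)) := by
    simp [projMat, Matrix.trace, Matrix.mul_apply, dotProduct, Matrix.mulVec, Fin.sum_univ_two]
    ring
  rw [h2]
  exact (Complex.le_def.1 h).1

lemma proj_psd (φ : EuclideanSpace ℂ (Fin 2)) : (projMat φ).PosSemidef := by
  have : projMat φ = Matrix.vecMulVec (fun i => φ i) (star (fun i => φ i)) := by
    ext i j
    simp [projMat, Matrix.vecMulVec_apply]
  rw [this]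
  exact Matrix.posSemidef_vecMulVec_self_star _

lemma one_sub_proj (ψ : EuclideanSpace ℂ (Fin 2)) (h : ‖ψ‖ = 1) :
    1 - projMat ψ = projMat !₂[-(starRingEnd ℂ) (ψ 1), (starRingEnd ℂ) (ψ 0)] := by
  have h1 := unit_coords ψ h
  ext i j
  fin_cases i <;> fin_cases j <;> apply Complex.ext <;> simp [projMat] <;> linarith

lemma mistake_nonneg (Φ : Matrix (Fin 2) (Fin 2) ℂ →ₗ[ℂ] Matrix (Fin 2) (Fin 2) ℂ)
    (hΦ : ∀ ρ : Matrix (Fin 2) (Fin 2) ℂ, ρ.PosSemidef → (Φ ρ).PosSemidef)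
    (ψ : EuclideanSpace ℂ (Fin 2)) (h : ‖ψ‖ = 1) : 0 ≤ mistakeRate Φ ψ := by
  unfold mistakeRate
  rw [one_sub_proj ψ h]
  exact proj_nonneg _ (hΦ _ (proj_psd ψ)) _

lemma mistake_quad (Φ : Matrix (Fin 2) (Fin 2) ℂ →ₗ[ℂ] Matrix (Fin 2) (Fin 2) ℂ) :
    ∃ c b1 b2 b3 q11 q22 q33 q12 q13 q23 : ℝ,
      ∀ ψ : EuclideanSpace ℂ (Fin 2), ‖ψ‖ = 1 → mistakeRate Φ ψ =
        quadPoly c b1 b2 b3 q11 q22 q33 q12 q13 q23 (blX ψ) (blY ψ) (blZ ψ) := by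
  let S1 : Matrix (Fin 2) (Fin 2) ℂ := !![0, 1; 1, 0]
  let S2 : Matrix (Fin 2) (Fin 2) ℂ := !![0, -Complex.I; Complex.I, 0]
  let S3 : Matrix (Fin 2) (Fin 2) ℂ := !![1, 0; 0, -1]
  let t : Matrix (Fin 2) (Fin 2) ℂ → Matrix (Fin 2) (Fin 2) ℂ → ℝ :=
    fun M N => ((Φ M * N).trace).re
  refine ⟨t 1 1 / 4, (t S1 1 - t 1 S1) / 4, (t S2 1 - t 1 S2) / 4, (t S3 1 - t 1 S3) / 4,
    -t S1 S1 / 4, -t S2 S2 / 4, -t S3 S3 / 4, -(t S1 S2 + t S2 S1) / 4,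
    -(t S1 S3 + t S3 S1) / 4, -(t S2 S3 + t S3 S2) / 4, ?_⟩
  intro ψ h
  have h1 := unit_coords ψ h
  have hp : projMat ψ = ((1 / 2 : ℝ) : ℂ) • (1 + (blX ψ : ℂ) • S1 + (blY ψ : ℂ) • S2
      + (blZ ψ : ℂ) • S3) := by
    ext i j
    fin_cases i <;> fin_cases j <;> apply Complex.ext <;>
      simp [projMat, S1, S2, S3, blX, blY, blZ, -Complex.ofReal_add,
        -Complex.ofReal_sub, -Complex.ofReal_mul, -Complex.ofReal_pow] <;> linarith
  have hq : 1 - projMat ψ = ((1 / 2 : ℝ) : ℂ) • (1 - (blX ψ : ℂ) • S1 - (blY ψ : ℂ) • S2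
      - (blZ ψ : ℂ) • S3) := by
    rw [hp]
    have : (1 : Matrix (Fin 2) (Fin 2) ℂ) = ((1 / 2 : ℝ) : ℂ) • (1 + 1) := by
      rw [smul_add, ← add_smul]; norm_num
    nth_rewrite 1 [this]
    rw [← smul_sub]
    congr 1
    abel
  unfold mistakeRate
  rw [hq, hp]
  generalize blX ψ = x
  generalize blY ψ = y
  generalize blZ ψ = z
  simp only [map_smul, map_add, Matrix.smul_mul, Matrix.mul_smul, mul_sub, add_mul,
    Matrix.trace_smul, Matrix.trace_add, Matrix.trace_sub, smul_eq_mul, Complex.re_ofReal_mul,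
    Complex.add_re, Complex.sub_re, quadPoly, t]
  ring

lemma quad_bound (c b1 b2 b3 q11 q22 q33 q12 q13 q23 : ℝ)
    (hpos : ∀ x y z : ℝ, x ^ 2 + y ^ 2 + z ^ 2 = 1 →
      0 ≤ quadPoly c b1 b2 b3 q11 q22 q33 q12 q13 q23 x y z)
    (ψ : EuclideanSpace ℂ (Fin 2)) (h : ‖ψ‖ = 1) :
    quadPoly c b1 b2 b3 q11 q22 q33 q12 q13 q23 (blX ψ) (blY ψ) (blZ ψ) ≤
      4 * (c + (q11 + q22 + q33) / 3) := by
  have h1 := unit_coords ψ h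
  obtain ⟨x, y, z, u1, u2, u3, v1, v2, v3, hx, hy, hz, hn, hu, hv, hnu, hnv,
      e11, e22, e33, e12, e13, e23⟩ :
      ∃ x y z u1 u2 u3 v1 v2 v3 : ℝ, blX ψ = x ∧ blY ψ = y ∧ blZ ψ = z ∧
        x ^ 2 + y ^ 2 + z ^ 2 = 1 ∧ u1 ^ 2 + u2 ^ 2 + u3 ^ 2 = 1 ∧
        v1 ^ 2 + v2 ^ 2 + v3 ^ 2 = 1 ∧ x * u1 + y * u2 + z * u3 = 0 ∧
        x * v1 + y * v2 + z * v3 = 0 ∧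
        x ^ 2 + u1 ^ 2 + v1 ^ 2 = 1 ∧ y ^ 2 + u2 ^ 2 + v2 ^ 2 = 1 ∧ z ^ 2 + u3 ^ 2 + v3 ^ 2 = 1 ∧
        x * y + u1 * u2 + v1 * v2 = 0 ∧ x * z + u1 * u3 + v1 * v3 = 0 ∧
        y * z + u2 * u3 + v2 * v3 = 0 := by
    unfold blX blY blZ
    generalize (ψ 0).re = p at *
    generalize (ψ 0).im = q at *
    generalize (ψ 1).re = r at *
    generalize (ψ 1).im = s at *
    refine ⟨_, _, _, p ^ 2 - q ^ 2 - r ^ 2 + s ^ 2, -(2 * p * q + 2 * r * s), -2 * (p * r - q * s),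
      2 * p * q - 2 * r * s, p ^ 2 - q ^ 2 + r ^ 2 - s ^ 2, -2 * (p * s + q * r), rfl, rfl, rfl,
      ?_, ?_, ?_, ?_, ?_, ?_, ?_, ?_, ?_, ?_, ?_⟩
    all_goals first
      | ring1
      | linear_combination (p ^ 2 + q ^ 2 + r ^ 2 + s ^ 2 + 1) * h1
  rw [hx, hy, hz]
  obtain ⟨r, hr⟩ : ∃ r : ℝ, r ^ 2 = 8 / 9 := ⟨√(8 / 9), Real.sq_sqrt (by norm_num)⟩
  have k1 := hpos (-x / 3 + r * u1) (-y / 3 + r * u2) (-z / 3 + r * u3)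
    (by linear_combination hn / 9 + r ^ 2 * hu - 2 / 3 * r * hnu + hr)
  have k2 := hpos (-x / 3 - r * u1) (-y / 3 - r * u2) (-z / 3 - r * u3)
    (by linear_combination hn / 9 + r ^ 2 * hu + 2 / 3 * r * hnu + hr)
  have k3 := hpos (-x / 3 + r * v1) (-y / 3 + r * v2) (-z / 3 + r * v3)
    (by linear_combination hn / 9 + r ^ 2 * hv - 2 / 3 * r * hnv + hr)
  have k4 := hpos (-x / 3 - r * v1) (-y / 3 - r * v2) (-z / 3 - r * v3)
    (by linear_combination hn / 9 + r ^ 2 * hv + 2 / 3 * r * hnv + hr)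
  unfold quadPoly at *
  have key : 4 * (c + (q11 + q22 + q33) / 3) = (c + b1 * x + b2 * y + b3 * z + q11 * x ^ 2
      + q22 * y ^ 2 + q33 * z ^ 2 + q12 * (x * y) + q13 * (x * z) + q23 * (y * z))
      + 3 * c - b1 * x - b2 * y - b3 * z
      + q11 * (x ^ 2 / 3 + 3 / 2 * r ^ 2 * (u1 ^ 2 + v1 ^ 2))
      + q22 * (y ^ 2 / 3 + 3 / 2 * r ^ 2 * (u2 ^ 2 + v2 ^ 2))
      + q33 * (z ^ 2 / 3 + 3 / 2 * r ^ 2 * (u3 ^ 2 + v3 ^ 2))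
      + q12 * (x * y / 3 + 3 / 2 * r ^ 2 * (u1 * u2 + v1 * v2))
      + q13 * (x * z / 3 + 3 / 2 * r ^ 2 * (u1 * u3 + v1 * v3))
      + q23 * (y * z / 3 + 3 / 2 * r ^ 2 * (u2 * u3 + v2 * v3)) := by
    rw [hr]
    linear_combination (-4 / 3) * (q11 * e11 + q22 * e22 + q33 * e33 + q12 * e12 + q13 * e13
      + q23 * e23)
  rw [key]
  linarith

lemma exists_U (α β γ δ : ℂ)
    (h : ∀ a b : ℂ, Complex.normSq (α * a + β * b) + Complex.normSq (γ * a + δ * b) =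
      Complex.normSq a + Complex.normSq b) :
    ∃ U : EuclideanSpace ℂ (Fin 2) ≃ₗᵢ[ℂ] EuclideanSpace ℂ (Fin 2),
      ∀ ψ, U ψ 0 = α * ψ 0 + β * ψ 1 ∧ U ψ 1 = γ * ψ 0 + δ * ψ 1 := by
  let f : EuclideanSpace ℂ (Fin 2) →ₗ[ℂ] EuclideanSpace ℂ (Fin 2) :=
    { toFun := fun ψ => !₂[α * ψ 0 + β * ψ 1, γ * ψ 0 + δ * ψ 1]
      map_add' := by
        intro x y
        ext i
        fin_cases i <;> simp <;> ring
      map_smul' := by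
        intro c x
        ext i
        fin_cases i <;> simp <;> ring }
  let g : EuclideanSpace ℂ (Fin 2) →ₗᵢ[ℂ] EuclideanSpace ℂ (Fin 2) :=
    { f with
      norm_map' := by
        intro x
        change ‖f x‖ = ‖x‖
        rw [EuclideanSpace.norm_eq, EuclideanSpace.norm_eq]
        congr 1
        simp only [Fin.sum_univ_two, Complex.sq_norm]
        exact h (x 0) (x 1) }
  refine ⟨g.toLinearIsometryEquiv rfl, fun ψ => ⟨rfl, rfl⟩⟩

abbrev Sph := Metric.sphere (0 : EuclideanSpace ℂ (Fin 2)) 1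

lemma map_sph (U : EuclideanSpace ℂ (Fin 2) ≃ₗᵢ[ℂ] EuclideanSpace ℂ (Fin 2)) (ψ : Sph) :
    U ψ.1 ∈ Metric.sphere (0 : EuclideanSpace ℂ (Fin 2)) 1 :=
  mem_sphere_zero_iff_norm.mpr ((U.norm_map ψ.1).trans (mem_sphere_zero_iff_norm.mp ψ.2))

lemma inv_int (μ : Measure Sph)
    (hinv : ∀ U : EuclideanSpace ℂ (Fin 2) ≃ₗᵢ[ℂ] EuclideanSpace ℂ (Fin 2),
      μ.map (fun ψ : Metric.sphere (0 : EuclideanSpace ℂ (Fin 2)) 1 =>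
        (⟨U ψ.1, map_sph U ψ⟩ :
              Metric.sphere (0 : EuclideanSpace ℂ (Fin 2)) 1)) = μ)
    (U : EuclideanSpace ℂ (Fin 2) ≃ₗᵢ[ℂ] EuclideanSpace ℂ (Fin 2))
    (F : EuclideanSpace ℂ (Fin 2) → ℝ) (hF : Continuous F) :
    ∫ ψ : Sph, F (U ψ.1) ∂μ = ∫ ψ : Sph, F ψ.1 ∂μ := by
  have hc : Continuous (fun ψ : Metric.sphere (0 : EuclideanSpace ℂ (Fin 2)) 1 =>
        (⟨U ψ.1, map_sph U ψ⟩ :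
              Metric.sphere (0 : EuclideanSpace ℂ (Fin 2)) 1)) :=
    Continuous.subtype_mk (U.continuous.comp continuous_subtype_val) _
  have hG : Continuous (fun ψ : Sph => F ψ.1) := hF.comp continuous_subtype_val
  conv_rhs => rw [← hinv U]
  rw [integral_map hc.measurable.aemeasurable hG.aestronglyMeasurable]

lemma cont_blX : Continuous blX := by unfold blX; fun_prop
lemma cont_blY : Continuous blY := by unfold blY; fun_prop
lemma cont_blZ : Continuous blZ := by unfold blZ; fun_prop

lemma cont_integrable (μ : Measure Sph) [IsProbabilityMeasure μ]
    (F : EuclideanSpace ℂ (Fin 2) → ℝ) (hF : Continuous F) :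
    Integrable (fun ψ : Sph => F ψ.1) μ :=
  (hF.comp continuous_subtype_val).integrable_of_hasCompactSupport
    (HasCompactSupport.of_compactSpace _)

lemma avg_quad (μ : Measure Sph) [IsProbabilityMeasure μ]
    (hinv : ∀ U : EuclideanSpace ℂ (Fin 2) ≃ₗᵢ[ℂ] EuclideanSpace ℂ (Fin 2),
      μ.map (fun ψ : Metric.sphere (0 : EuclideanSpace ℂ (Fin 2)) 1 =>
        (⟨U ψ.1, map_sph U ψ⟩ :
              Metric.sphere (0 : EuclideanSpace ℂ (Fin 2)) 1)) = μ)
    (c b1 b2 b3 q11 q22 q33 q12 q13 q23 : ℝ) :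
    ∫ ψ : Sph, quadPoly c b1 b2 b3 q11 q22 q33 q12 q13 q23 (blX ψ.1) (blY ψ.1) (blZ ψ.1) ∂μ
      = c + (q11 + q22 + q33) / 3 := by
  have cX := cont_blX
  have cY := cont_blY
  have cZ := cont_blZ
  obtain ⟨U1, hU1⟩ := exists_U 1 0 0 (-1) (by intro a b; simp)
  obtain ⟨U2, hU2⟩ := exists_U 0 1 1 0 (by intro a b; simp [add_comm])
  obtain ⟨U3, hU3⟩ := exists_U 1 0 0 Complex.I (by intro a b; simp)
  have hs : (√2 / 2 : ℝ) ^ 2 = 1 / 2 := by rw [div_pow, Real.sq_sqrt] <;> norm_num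
  generalize √2 / 2 = w at hs
  obtain ⟨U4, hU4⟩ := exists_U w w w (-w) (by
    intro a b
    simp [Complex.normSq_apply]
    linear_combination (2 * (a.re ^ 2 + a.im ^ 2 + b.re ^ 2 + b.im ^ 2)) * hs)
  have x1 : ∀ ψ, blX (U1 ψ) = - blX ψ := by
    intro ψ; simp [blX, hU1]; ring
  have y1 : ∀ ψ, blY (U1 ψ) = - blY ψ := by
    intro ψ; simp [blY, hU1]; ring
  have z1 : ∀ ψ, blZ (U1 ψ) = blZ ψ := by
    intro ψ; simp [blZ, hU1]
  have x2 : ∀ ψ, blX (U2 ψ) = blX ψ := by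
    intro ψ; simp [blX, hU2]; ring
  have y2 : ∀ ψ, blY (U2 ψ) = - blY ψ := by
    intro ψ; simp [blY, hU2]; ring
  have z2 : ∀ ψ, blZ (U2 ψ) = - blZ ψ := by
    intro ψ; simp [blZ, hU2]; ring
  have x3 : ∀ ψ, blX (U3 ψ) = - blY ψ := by
    intro ψ; simp [blX, blY, hU3]; ring
  have x4 : ∀ ψ, blX (U4 ψ) = blZ ψ := by
    intro ψ; simp [blX, blZ, hU4]
    linear_combination 2 * ((ψ 0).re ^ 2 + (ψ 0).im ^ 2 - (ψ 1).re ^ 2 - (ψ 1).im ^ 2) * hs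
  have iX : ∫ ψ : Sph, blX ψ.1 ∂μ = 0 := by
    have := inv_int μ hinv U1 blX cX
    simp only [x1, integral_neg] at this
    linarith
  have iY : ∫ ψ : Sph, blY ψ.1 ∂μ = 0 := by
    have := inv_int μ hinv U1 blY cY
    simp only [y1, integral_neg] at this
    linarith
  have iZ : ∫ ψ : Sph, blZ ψ.1 ∂μ = 0 := by
    have := inv_int μ hinv U2 blZ cZ
    simp only [z2, integral_neg] at this
    linarith
  have iXY : ∫ ψ : Sph, blX ψ.1 * blY ψ.1 ∂μ = 0 := by
    have := inv_int μ hinv U2 (fun ψ => blX ψ * blY ψ) (by fun_prop)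
    simp only [x2, y2, mul_neg, integral_neg] at this
    linarith
  have iXZ : ∫ ψ : Sph, blX ψ.1 * blZ ψ.1 ∂μ = 0 := by
    have := inv_int μ hinv U2 (fun ψ => blX ψ * blZ ψ) (by fun_prop)
    simp only [x2, z2, mul_neg, integral_neg] at this
    linarith
  have iYZ : ∫ ψ : Sph, blY ψ.1 * blZ ψ.1 ∂μ = 0 := by
    have := inv_int μ hinv U1 (fun ψ => blY ψ * blZ ψ) (by fun_prop)
    simp only [y1, z1, neg_mul, integral_neg] at this
    linarith
  have eXY : ∫ ψ : Sph, blY ψ.1 ^ 2 ∂μ = ∫ ψ : Sph, blX ψ.1 ^ 2 ∂μ := by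
    have := inv_int μ hinv U3 (fun ψ => blX ψ ^ 2) (by fun_prop)
    simpa only [x3, neg_sq] using this
  have eXZ : ∫ ψ : Sph, blZ ψ.1 ^ 2 ∂μ = ∫ ψ : Sph, blX ψ.1 ^ 2 ∂μ := by
    have := inv_int μ hinv U4 (fun ψ => blX ψ ^ 2) (by fun_prop)
    simpa only [x4] using this
  have I := cont_integrable μ
  have jX := I blX cX
  have jY := I blY cY
  have jZ := I blZ cZ
  have jXX := I (fun ψ => blX ψ ^ 2) (by fun_prop)
  have jYY := I (fun ψ => blY ψ ^ 2) (by fun_prop)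
  have jZZ := I (fun ψ => blZ ψ ^ 2) (by fun_prop)
  have jXY := I (fun ψ => blX ψ * blY ψ) (by fun_prop)
  have jXZ := I (fun ψ => blX ψ * blZ ψ) (by fun_prop)
  have jYZ := I (fun ψ => blY ψ * blZ ψ) (by fun_prop)
  have tot : ∫ ψ : Sph, (blX ψ.1 ^ 2 + blY ψ.1 ^ 2 + blZ ψ.1 ^ 2) ∂μ = 1 := by
    have : ∀ ψ : Sph, blX ψ.1 ^ 2 + blY ψ.1 ^ 2 + blZ ψ.1 ^ 2 = 1 :=
      fun ψ => bloch_unit _ (mem_sphere_zero_iff_norm.mp ψ.2)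
    simp [this]
  rw [integral_add (by fun_prop) (by fun_prop), integral_add (by fun_prop) (by fun_prop),
    eXY, eXZ] at tot
  unfold quadPoly
  rw [integral_add (by fun_prop) (by fun_prop), integral_add (by fun_prop) (by fun_prop),
    integral_add (by fun_prop) (by fun_prop), integral_add (by fun_prop) (by fun_prop),
    integral_add (by fun_prop) (by fun_prop), integral_add (by fun_prop) (by fun_prop),
    integral_add (by fun_prop) (by fun_prop), integral_add (by fun_prop) (by fun_prop),
    integral_add (by fun_prop) (by fun_prop)]
  simp only [integral_const_mul, iX, iY, iZ, iXY, iXZ, iYZ, eXY, eXZ]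
  simp
  linear_combination (q11 + q22 + q33) / 3 * tot

theorem stmt19 (Φ : Matrix (Fin 2) (Fin 2) ℂ →ₗ[ℂ] Matrix (Fin 2) (Fin 2) ℂ)
    (hΦ : ∀ ρ : Matrix (Fin 2) (Fin 2) ℂ, ρ.PosSemidef → (Φ ρ).PosSemidef)
    (μ : Measure (Metric.sphere (0 : EuclideanSpace ℂ (Fin 2)) 1))
    [IsProbabilityMeasure μ]
    (hinv : ∀ U : EuclideanSpace ℂ (Fin 2) ≃ₗᵢ[ℂ] EuclideanSpace ℂ (Fin 2),
      μ.map (fun ψ : Metric.sphere (0 : EuclideanSpace ℂ (Fin 2)) 1 =>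
        (⟨U ψ.1, by
          simpa [mem_sphere_zero_iff_norm, U.norm_map] using
            mem_sphere_zero_iff_norm.mp ψ.2⟩ :
              Metric.sphere (0 : EuclideanSpace ℂ (Fin 2)) 1)) = μ) :
    (∫ ψ : Metric.sphere (0 : EuclideanSpace ℂ (Fin 2)) 1, mistakeRate Φ ψ.1 ∂μ) ≤
        (⨆ ψ : Metric.sphere (0 : EuclideanSpace ℂ (Fin 2)) 1, mistakeRate Φ ψ.1) ∧
      (⨆ ψ : Metric.sphere (0 : EuclideanSpace ℂ (Fin 2)) 1, mistakeRate Φ ψ.1) ≤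
        4 * ∫ ψ : Metric.sphere (0 : EuclideanSpace ℂ (Fin 2)) 1, mistakeRate Φ ψ.1 ∂μ := by
  obtain ⟨c, b1, b2, b3, q11, q22, q33, q12, q13, q23, hq⟩ := mistake_quad Φ
  have hq' : ∀ ψ : Metric.sphere (0 : EuclideanSpace ℂ (Fin 2)) 1, mistakeRate Φ ψ.1 =
      quadPoly c b1 b2 b3 q11 q22 q33 q12 q13 q23 (blX ψ.1) (blY ψ.1) (blZ ψ.1) :=
    fun ψ => hq ψ.1 (mem_sphere_zero_iff_norm.mp ψ.2)
  have hpos : ∀ x y z : ℝ, x ^ 2 + y ^ 2 + z ^ 2 = 1 →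
      0 ≤ quadPoly c b1 b2 b3 q11 q22 q33 q12 q13 q23 x y z := by
    intro x y z h
    obtain ⟨ψ, hψ, rfl, rfl, rfl⟩ := bloch_surj x y z h
    rw [← hq ψ hψ]
    exact mistake_nonneg Φ hΦ ψ hψ
  have hb := fun ψ : Metric.sphere (0 : EuclideanSpace ℂ (Fin 2)) 1 =>
    quad_bound c b1 b2 b3 q11 q22 q33 q12 q13 q23 hpos ψ.1 (mem_sphere_zero_iff_norm.mp ψ.2)
  have hav := avg_quad μ hinv c b1 b2 b3 q11 q22 q33 q12 q13 q23
  have hint := cont_integrable μ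
    (fun ψ => quadPoly c b1 b2 b3 q11 q22 q33 q12 q13 q23 (blX ψ) (blY ψ) (blZ ψ)) (by
      have cX := cont_blX
      have cY := cont_blY
      have cZ := cont_blZ
      unfold quadPoly
      fun_prop)
  have hne : Nonempty (Metric.sphere (0 : EuclideanSpace ℂ (Fin 2)) 1) := by
    obtain ⟨ψ, hψ, -⟩ := bloch_surj 1 0 0 (by norm_num)
    exact ⟨⟨ψ, mem_sphere_zero_iff_norm.mpr hψ⟩⟩
  simp only [hq']
  constructor
  · have hbd : BddAbove (Set.range fun ψ : Metric.sphere (0 : EuclideanSpace ℂ (Fin 2)) 1 =>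
        quadPoly c b1 b2 b3 q11 q22 q33 q12 q13 q23 (blX ψ.1) (blY ψ.1) (blZ ψ.1)) := by
      refine ⟨4 * (c + (q11 + q22 + q33) / 3), ?_⟩
      rintro _ ⟨ψ, rfl⟩
      exact hb ψ
    have hm := integral_mono hint (integrable_const _) (fun ψ => le_ciSup hbd ψ)
    rw [integral_const] at hm
    simpa using hm
  · rw [hav]
    exact ciSup_le hb
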